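/- Let d ≥ 1, m > 1, m* = m/(m−1), and suppose (b,V) satisfies hypothesis (H1) with parameters δ = 0, ρ > 0, a ∈ ℝ, η > 0, R > 0. If η > 1 and a < d − 1, then λ_max(β) < ρ^{m*}/m* for every β ≥ 0, and lim_{β→∞} λ_max(β) = ρ^{m*}/m*. -/

import Mathlib

open Filter Real RealInnerProductSpace

noncomputable section

abbrev Euc (d : ℕ) := EuclideanSpace ℝ (Fin d)

/-- The Laplacian of `φ`, defined as the sum of the second partial derivatives
in the coordinate directions. -/
def lap {d : ℕ} (φ : Euc d → ℝ) (x : Euc d) : ℝ :=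
  ∑ i : Fin d, fderiv ℝ (fun y => fderiv ℝ φ y (EuclideanSpace.single i 1)) x
    (EuclideanSpace.single i 1)

/-- `(lam, φ)` is a subsolution of the ergodic problem (EP). -/
def IsSubsol {d : ℕ} (m : ℝ) (b : Euc d → Euc d) (V : Euc d → ℝ) (β lam : ℝ)
    (φ : Euc d → ℝ) : Prop :=
  ContDiff ℝ 3 φ ∧ ∀ x : Euc d,
    lam - lap φ x + ⟪b x, gradient φ x⟫ + (1 / m) * ‖gradient φ x‖ ^ m - β * V x ≤ 0

/-- The generalized principal eigenvalue `λ_max(β)`. -/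
def lamMax {d : ℕ} (m : ℝ) (b : Euc d → Euc d) (V : Euc d → ℝ) (β : ℝ) : ℝ :=
  sSup {lam : ℝ | ∃ φ : Euc d → ℝ, IsSubsol m b V β lam φ}

/-- Hypothesis (H0) with parameter `δ` and constants `ρ, R` and auxiliary function `α`. -/
def HypH0 {d : ℕ} (δ ρ R : ℝ) (b : Euc d → Euc d) (V : Euc d → ℝ) (α : Euc d → ℝ) : Prop :=
  ContDiff ℝ 2 b ∧ ContDiff ℝ 2 V ∧ (∃ M : ℝ, ∀ x : Euc d, ‖gradient V x‖ ≤ M) ∧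
  ContDiff ℝ 2 α ∧
  (∀ x : Euc d, R ≤ ‖x‖ → b x = ((ρ + α x) * ‖x‖ ^ (δ - 1)) • x) ∧
  Tendsto α (cocompact (Euc d)) (nhds 0) ∧
  (∀ x : Euc d, 0 ≤ V x) ∧
  Metric.closedBall (0 : Euc d) R ⊆ interior (Function.support V) ∧
  Tendsto V (cocompact (Euc d)) (nhds 0)

/-- Hypothesis (H1): (H0) together with `α(x) = a|x|⁻¹` and `V(x) = |x|^{-η}` outside `B_R`. -/
def HypH1 {d : ℕ} (δ ρ R a η : ℝ) (b : Euc d → Euc d) (V : Euc d → ℝ) (α : Euc d → ℝ) : Prop :=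
  HypH0 δ ρ R b V α ∧
  ∀ x : Euc d, R ≤ ‖x‖ → α x = a * ‖x‖⁻¹ ∧ V x = ‖x‖ ^ (-η)



lemma rad_fderiv {d : ℕ} (F : ℝ → ℝ) (f : ℝ) (x : Euc d)
    (h : HasDerivAt F f (‖x‖ ^ 2)) :
    HasFDerivAt (fun y : Euc d => F (‖y‖ ^ 2)) ((2 * f) • (innerSL ℝ x)) x := by
  have h1 : HasFDerivAt (fun y : Euc d => ‖y‖ ^ 2) (2 • (innerSL ℝ x)) x :=
    (hasStrictFDerivAt_norm_sq x).hasFDerivAt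
  have h2 := h.comp_hasFDerivAt x h1
  refine h2.congr_fderiv ?_
  ext y
  simp only [smul_apply, innerSL_apply_apply, smul_eq_mul, nsmul_eq_mul]
  push_cast
  ring

lemma rad_grad {d : ℕ} (F : ℝ → ℝ) (f : ℝ) (x : Euc d)
    (h : HasDerivAt F f (‖x‖ ^ 2)) :
    gradient (fun y : Euc d => F (‖y‖ ^ 2)) x = (2 * f) • x := by
  apply HasGradientAt.gradient
  rw [hasGradientAt_iff_hasFDerivAt]
  refine (rad_fderiv F f x h).congr_fderiv ?_
  ext y
  simp

lemma rad_second {d : ℕ} (F F1 : ℝ → ℝ) (f2 : ℝ) (x : Euc d)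
    (h : ∀ᶠ t in nhds (‖x‖ ^ 2), HasDerivAt F (F1 t) t)
    (h2 : HasDerivAt F1 f2 (‖x‖ ^ 2)) (i : Fin d) :
    HasFDerivAt (fun y => fderiv ℝ (fun y : Euc d => F (‖y‖ ^ 2)) y (EuclideanSpace.single i 1))
      ((2 * F1 (‖x‖ ^ 2)) • (innerSL ℝ (EuclideanSpace.single i (1 : ℝ) : Euc d)) +
        (4 * f2 * x i) • innerSL ℝ x) x := by
  have hc : ContinuousAt (fun y : Euc d => ‖y‖ ^ 2) x := by fun_prop
  have he : (fun y => fderiv ℝ (fun y : Euc d => F (‖y‖ ^ 2)) y (EuclideanSpace.single i 1))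
      =ᶠ[nhds x] fun y => 2 * F1 (‖y‖ ^ 2) * ⟪(EuclideanSpace.single i (1 : ℝ) : Euc d), y⟫ := by
    filter_upwards [hc.eventually h] with y hy
    rw [(rad_fderiv F _ y hy).fderiv]
    simp [real_inner_comm]
  refine HasFDerivAt.congr_of_eventuallyEq ?_ he
  have h3 := ((rad_fderiv F1 f2 x h2).const_mul 2).mul
    (innerSL ℝ (EuclideanSpace.single i (1 : ℝ) : Euc d)).hasFDerivAt (x := x)
  refine h3.congr_fderiv ?_
  ext y
  simp [EuclideanSpace.inner_single_left]
  ring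

lemma rad_lap {d : ℕ} (F F1 : ℝ → ℝ) (f2 : ℝ) (x : Euc d)
    (h : ∀ᶠ t in nhds (‖x‖ ^ 2), HasDerivAt F (F1 t) t)
    (h2 : HasDerivAt F1 f2 (‖x‖ ^ 2)) :
    lap (fun y : Euc d => F (‖y‖ ^ 2)) x = 2 * d * F1 (‖x‖ ^ 2) + 4 * ‖x‖ ^ 2 * f2 := by
  unfold lap
  have : ∀ i : Fin d, fderiv ℝ (fun y => fderiv ℝ (fun y : Euc d => F (‖y‖ ^ 2)) y
      (EuclideanSpace.single i 1)) x (EuclideanSpace.single i 1) =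
      2 * F1 (‖x‖ ^ 2) + 4 * f2 * (x i) ^ 2 := by
    intro i
    rw [(rad_second F F1 f2 x h h2 i).fderiv]
    simp [EuclideanSpace.inner_single_right]
    ring
  have hn : ∑ i, x i ^ 2 = ‖x‖ ^ 2 := (EuclideanSpace.real_norm_sq_eq x).symm
  rw [Finset.sum_congr rfl (fun i _ => this i), Finset.sum_add_distrib, ← Finset.mul_sum,
    ← Finset.mul_sum, hn]
  simp only [Finset.sum_const, Finset.card_univ, Fintype.card_fin, nsmul_eq_mul]
  ring

lemma second_nonpos (g g1 : ℝ → ℝ) (g2 : ℝ) (h : ∀ᶠ t in nhds 0, HasDerivAt g (g1 t) t)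
    (h2 : HasDerivAt g1 g2 0) (hm : IsLocalMax g 0) : g2 ≤ 0 := by
  by_contra hc
  push Not at hc
  have he : deriv g =ᶠ[nhds 0] g1 := by
    filter_upwards [h] with t ht using ht.deriv
  have h0 : deriv g 0 = 0 := hm.deriv_eq_zero
  have h3 : deriv (deriv g) 0 = g2 := by rw [he.deriv_eq]; exact h2.deriv
  have h4 : IsLocalMin g 0 := isLocalMin_of_deriv_deriv_pos (by rw [h3]; exact hc) h0
    h.self_of_nhds.continuousAt
  have h5 : g =ᶠ[nhds 0] fun _ => g 0 := by
    filter_upwards [hm, h4] with t h1 h2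
    exact le_antisymm h1 h2
  have h6 : deriv g =ᶠ[nhds 0] fun _ => 0 := by
    have := h5.deriv
    simpa using this
  have : deriv (deriv g) 0 = 0 := by rw [h6.deriv_eq]; simp
  linarith

lemma dir_second_nonpos {d : ℕ} (u : Euc d → ℝ) (x e : Euc d) (w : Euc d → ℝ) (w' : Euc d →L[ℝ] ℝ)
    (hu : ∀ᶠ y in nhds x, HasLineDerivAt ℝ u (w y) y e) (hw : HasFDerivAt w w' x)
    (hm : IsLocalMax u x) : w' e ≤ 0 := by
  have hc : ContinuousAt (fun t : ℝ => x + t • e) 0 := by fun_prop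
  have hx : x + (0 : ℝ) • e = x := by simp
  have hc' : Tendsto (fun t : ℝ => x + t • e) (nhds 0) (nhds x) := by
    have := hc.tendsto; rwa [hx] at this
  refine second_nonpos (fun t => u (x + t • e)) (fun t => w (x + t • e)) (w' e) ?_ ?_ ?_
  · filter_upwards [hc'.eventually hu] with t ht
    unfold HasLineDerivAt at ht
    have h1 : HasDerivAt (fun s : ℝ => u (x + t • e + s • e)) (w (x + t • e)) (t - t) := by
      simpa using ht
    have h2 := h1.comp_sub_const t t
    refine h2.congr_of_eventuallyEq (Eventually.of_forall fun s => ?_)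
    simp only
    congr 1
    module
  · exact hw.hasLineDerivAt e
  · have := hc'.eventually hm
    unfold IsLocalMax IsMaxFilter
    filter_upwards [this] with t ht
    simpa using ht

lemma max_point {d : ℕ} (φ : Euc d → ℝ) (hφ : ContDiff ℝ 3 φ) (F F1 : ℝ → ℝ) (f2 : ℝ) (x : Euc d)
    (h : ∀ᶠ t in nhds (‖x‖ ^ 2), HasDerivAt F (F1 t) t)
    (h2 : HasDerivAt F1 f2 (‖x‖ ^ 2))
    (hm : IsLocalMax (fun y => φ y - F (‖y‖ ^ 2)) x) :
    gradient φ x = (2 * F1 (‖x‖ ^ 2)) • x ∧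
      lap φ x ≤ 2 * d * F1 (‖x‖ ^ 2) + 4 * ‖x‖ ^ 2 * f2 := by
  have hd : Differentiable ℝ φ := hφ.differentiable (by norm_num)
  constructor
  · rw [← rad_grad F _ x h.self_of_nhds]
    have h3 := hm.hasFDerivAt_eq_zero ((hd x).hasFDerivAt.sub (rad_fderiv F _ x h.self_of_nhds))
    unfold gradient
    rw [(rad_fderiv F _ x h.self_of_nhds).fderiv, sub_eq_zero.1 h3]
  · rw [← rad_lap F F1 f2 x h h2]
    unfold lap
    apply Finset.sum_le_sum
    intro i _
    have hr := rad_second F F1 f2 x h h2 i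
    have hp : Differentiable ℝ (fun y => fderiv ℝ φ y (EuclideanSpace.single i 1)) := by
      have : ContDiff ℝ 2 (fderiv ℝ φ) := hφ.fderiv_right (by norm_num)
      have := this.differentiable (by norm_num)
      fun_prop
    have key := dir_second_nonpos (fun y => φ y - F (‖y‖ ^ 2)) x (EuclideanSpace.single i 1)
      _ _ ?_ ((hp x).hasFDerivAt.sub hr) hm
    · rw [hr.fderiv]
      simpa using key
    · have hc : ContinuousAt (fun y : Euc d => ‖y‖ ^ 2) x := by fun_prop
      filter_upwards [hc.eventually h] with y hy
      have hy' := rad_fderiv F _ y hy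
      have := ((hd y).hasFDerivAt.sub hy').hasLineDerivAt (EuclideanSpace.single i 1)
      rw [← hy'.fderiv] at this
      exact this

lemma exists_touch {d : ℕ} (φ : Euc d → ℝ) (hφ : ContDiff ℝ 3 φ) (F F1 F2 : ℝ → ℝ) (L : ℝ)
    (hL : 0 < L)
    (h : ∀ t, -1 < t → t < L ^ 2 → HasDerivAt F (F1 t) t)
    (h2 : ∀ t, -1 < t → t < L ^ 2 → HasDerivAt F1 (F2 t) t)
    (hF : Tendsto F (nhdsWithin (L ^ 2) (Set.Iio (L ^ 2))) atTop) :
    ∃ x : Euc d, ‖x‖ < L ∧ gradient φ x = (2 * F1 (‖x‖ ^ 2)) • x ∧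
      lap φ x ≤ 2 * d * F1 (‖x‖ ^ 2) + 4 * ‖x‖ ^ 2 * F2 (‖x‖ ^ 2) := by
  suffices hs : ∃ x : Euc d, ‖x‖ < L ∧ IsLocalMax (fun y => φ y - F (‖y‖ ^ 2)) x by
    obtain ⟨x, hx, hm⟩ := hs
    refine ⟨x, hx, max_point φ hφ F F1 _ x ?_ (h2 _ (by nlinarith [sq_nonneg ‖x‖])
      (by gcongr)) hm⟩
    have : Set.Ioo (-1) (L ^ 2) ∈ nhds (‖x‖ ^ 2) :=
      Ioo_mem_nhds (by nlinarith [sq_nonneg ‖x‖]) (by gcongr)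
    filter_upwards [this] with t ht using h t ht.1 ht.2
  have hcφ : Continuous φ := hφ.continuous
  obtain ⟨M, hM⟩ := (isCompact_closedBall (0 : Euc d) L).bddAbove_image hcφ.continuousOn
  have hM' : ∀ x : Euc d, ‖x‖ ≤ L → φ x ≤ M := fun x hx =>
    hM ⟨x, by simpa using hx, rfl⟩
  have hev := hF.eventually_gt_atTop (M - (φ 0 - F 0))
  obtain ⟨l, hl, hlF⟩ := (mem_nhdsLT_iff_exists_Ioo_subset).1 hev
  obtain ⟨L', hL'0, hL'L, hL'l⟩ : ∃ L', 0 < L' ∧ L' < L ∧ l < L' ^ 2 := by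
    have hc : ContinuousAt (fun s : ℝ => s ^ 2) L := by fun_prop
    have h1 : ∀ᶠ s in nhdsWithin L (Set.Iio L), l < s ^ 2 :=
      (hc.eventually (lt_mem_nhds hl)).filter_mono nhdsWithin_le_nhds
    have h2 : ∀ᶠ s in nhdsWithin L (Set.Iio L), 0 < s :=
      (lt_mem_nhds hL).filter_mono nhdsWithin_le_nhds
    obtain ⟨s, h1, h2, h3⟩ := (h1.and (h2.and self_mem_nhdsWithin)).exists
    exact ⟨s, h2, h3, h1⟩
  have hcont : ContinuousOn (fun y : Euc d => φ y - F (‖y‖ ^ 2)) (Metric.closedBall 0 L') := by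
    intro y hy
    have hy' : ‖y‖ ≤ L' := by simpa using hy
    have hF' : ContinuousAt F (‖y‖ ^ 2) :=
      (h _ (by nlinarith [sq_nonneg ‖y‖]) (by gcongr; linarith)).continuousAt
    have : ContinuousAt (fun y : Euc d => F (‖y‖ ^ 2)) y :=
      ContinuousAt.comp (f := fun y : Euc d => ‖y‖ ^ 2) hF' (by fun_prop)
    exact (hcφ.continuousAt.sub this).continuousWithinAt
  obtain ⟨x, hx, hmax⟩ := (isCompact_closedBall (0 : Euc d) L').exists_isMaxOn
    ⟨0, by simp [hL'0.le]⟩ hcont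
  have hx' : ‖x‖ ≤ L' := by simpa using hx
  have h0 : φ 0 - F 0 ≤ φ x - F (‖x‖ ^ 2) := by
    have := hmax (show (0 : Euc d) ∈ Metric.closedBall 0 L' by simp [hL'0.le])
    simpa using this
  have hlt : ‖x‖ < L' := by
    rcases hx'.lt_or_eq with h | h
    · exact h
    · exfalso
      have := hlF (show ‖x‖ ^ 2 ∈ Set.Ioo l (L ^ 2) by rw [h]; exact ⟨hL'l, by gcongr⟩)
      have h3 := hM' x (by linarith)
      have : M - (φ 0 - F 0) < F (‖x‖ ^ 2) := this
      linarith
  refine ⟨x, by linarith, hmax.isLocalMax ?_⟩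
  exact Filter.mem_of_superset (Metric.isOpen_ball.mem_nhds (by simpa using hlt))
    Metric.ball_subset_closedBall

lemma young_rho (m ρ P : ℝ) (hm : 1 < m) (hρ : 0 < ρ) (hP : 0 ≤ P) :
    ρ * P ≤ P ^ m / m + ρ ^ (m / (m - 1)) / (m / (m - 1)) := by
  have := Real.young_inequality_of_nonneg hP hρ.le (Real.HolderConjugate.conjExponent hm)
  simp only [Real.conjExponent] at this
  linarith

/-- Exterior estimate. -/
lemma ext_bound (m ρ a η β R κ dd : ℝ) (hm : 1 < m) (hρ : 0 < ρ) (hβ : 0 ≤ β) (hR : 0 < R)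
    (hκ1 : κ < 1 / 2) (hc : 0 < dd - a - 2 + 2 * κ) (hη : 2 - 2 * κ ≤ η) :
    ∃ n1 : ℝ, ∀ n, n1 ≤ n → 0 < n → ∀ r, R ≤ r →
      -(dd * (n * (1 + r ^ 2) ^ (κ - 1)) - 2 * r ^ 2 * (n * (1 - κ) * (1 + r ^ 2) ^ (κ - 2)))
        + n * (1 + r ^ 2) ^ (κ - 1) * (ρ * r + a)
        - (n * (1 + r ^ 2) ^ (κ - 1) * r) ^ m / m + β * r ^ (-η)
      < ρ ^ (m / (m - 1)) / (m / (m - 1)) := by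
  set c := dd - a - 2 + 2 * κ with hcdef
  set D : ℝ := 1 + 1 / R ^ 2 with hD
  have hD0 : 0 < D := by positivity
  refine ⟨(β * R ^ (2 - 2 * κ - η) + 1) / (c * D ^ (κ - 1)), fun n hn hn0 r hr => ?_⟩
  have hr0 : 0 < r := lt_of_lt_of_le hR hr
  have hS : 0 < 1 + r ^ 2 := by positivity
  have e1 : (1 + r ^ 2) ^ (κ - 1) = (1 + r ^ 2) ^ (κ - 2) * (1 + r ^ 2) := by
    rw [← Real.rpow_add_one hS.ne']; congr 1; ring
  have hY := young_rho m ρ (n * (1 + r ^ 2) ^ (κ - 1) * r) hm hρ (by positivity)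
  have hlow : D ^ (κ - 1) * r ^ (2 * κ - 2) ≤ (1 + r ^ 2) ^ (κ - 1) := by
    have : D ^ (κ - 1) * r ^ (2 * κ - 2) = (D * r ^ 2) ^ (κ - 1) := by
      rw [Real.mul_rpow hD0.le (by positivity), ← Real.rpow_natCast_mul hr0.le]
      congr 2; push_cast; ring
    rw [this]
    apply Real.rpow_le_rpow_of_nonpos hS _ (by linarith)
    rw [hD, add_mul, one_mul]
    have : 1 ≤ 1 / R ^ 2 * r ^ 2 := by
      rw [one_div_mul_eq_div, le_div_iff₀ (by positivity), one_mul]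
      gcongr
    linarith
  have hV : r ^ (-η) ≤ R ^ (2 - 2 * κ - η) * r ^ (2 * κ - 2) := by
    have : r ^ (-η) = r ^ (2 - 2 * κ - η) * r ^ (2 * κ - 2) := by
      rw [← Real.rpow_add hr0]; congr 1; ring
    rw [this]
    have h1 : r ^ (2 - 2 * κ - η) ≤ R ^ (2 - 2 * κ - η) :=
      Real.rpow_le_rpow_of_nonpos hR hr (by linarith)
    gcongr
  have hrp : 0 < r ^ (2 * κ - 2) := by positivity
  rw [div_le_iff₀ (by positivity)] at hn
  have hkey : β * r ^ (-η) < n * c * (1 + r ^ 2) ^ (κ - 1) := by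
    calc β * r ^ (-η) ≤ β * (R ^ (2 - 2 * κ - η) * r ^ (2 * κ - 2)) := by gcongr
      _ < (β * R ^ (2 - 2 * κ - η) + 1) * r ^ (2 * κ - 2) := by nlinarith
      _ ≤ (n * (c * D ^ (κ - 1))) * r ^ (2 * κ - 2) := by gcongr
      _ = n * c * (D ^ (κ - 1) * r ^ (2 * κ - 2)) := by ring
      _ ≤ _ := by gcongr
  have hbr : -(dd * (n * (1 + r ^ 2) ^ (κ - 1)) -
      2 * r ^ 2 * (n * (1 - κ) * (1 + r ^ 2) ^ (κ - 2))) + n * (1 + r ^ 2) ^ (κ - 1) * a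
      ≤ - (n * c * (1 + r ^ 2) ^ (κ - 1)) := by
    have hp : 0 < n * (1 + r ^ 2) ^ (κ - 2) := by positivity
    rw [e1]
    have : 0 ≤ n * (1 + r ^ 2) ^ (κ - 2) * (2 - 2 * κ) :=
      mul_nonneg hp.le (by linarith)
    rw [hcdef]
    nlinarith
  nlinarith

/-- Interior estimate. -/
lemma int_bound (m β R κ dd K W : ℝ) (hm : 1 < m) (hβ : 0 ≤ β)
    (hκ0 : 0 < κ) (hκ1 : κ < 1 / 2) (hd : 1 ≤ dd) (hK : 1 ≤ K) (hW : 0 ≤ W) :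
    ∃ n2 : ℝ, ∀ n, n2 ≤ n → 0 < n → ∀ r, 0 ≤ r → r ≤ R → ∀ ib v, ib ≤ K * r → v ≤ W →
      -(dd * (n * (1 + r ^ 2) ^ (κ - 1)) - 2 * r ^ 2 * (n * (1 - κ) * (1 + r ^ 2) ^ (κ - 2)))
        + n * (1 + r ^ 2) ^ (κ - 1) * ib
        - (n * (1 + r ^ 2) ^ (κ - 1) * r) ^ m / m + β * v ≤ 0 := by
  obtain ⟨X, hX⟩ := (Filter.eventually_atTop.1 ((tendsto_rpow_atTop
    (show 0 < m - 1 by linarith)).eventually_ge_atTop (m * (9 * K + 1))))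
  set X' := max (max X (β * W)) 1 with hX'
  set c2 : ℝ := (1 + R ^ 2) ^ (-1 : ℝ) / (8 * K) with hc2
  have hc20 : 0 < c2 := by positivity
  refine ⟨max (16 * β * W) (X' / c2), fun n hn hn0 r hr0 hrR ib v hib hv => ?_⟩
  have hnA : 16 * β * W ≤ n := le_trans (le_max_left _ _) hn
  have hnB : X' / c2 ≤ n := le_trans (le_max_right _ _) hn
  have hS : 0 < 1 + r ^ 2 := by positivity
  have e1 : (1 + r ^ 2) ^ (κ - 1) = (1 + r ^ 2) ^ (κ - 2) * (1 + r ^ 2) := by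
    rw [← Real.rpow_add_one hS.ne']; congr 1; ring
  have hT : 0 < (1 + r ^ 2) ^ (κ - 2) := by positivity
  have hβv : β * v ≤ β * W := by gcongr
  have hbr : n * (1 + r ^ 2) ^ (κ - 2) * (1 - r ^ 2) ≤ dd * (n * (1 + r ^ 2) ^ (κ - 1)) -
      2 * r ^ 2 * (n * (1 - κ) * (1 + r ^ 2) ^ (κ - 2)) := by
    rw [e1]
    have hp : 0 < n * (1 + r ^ 2) ^ (κ - 2) := by positivity
    have h1 : 0 ≤ n * (1 + r ^ 2) ^ (κ - 2) * ((dd - 1) * (1 + r ^ 2) + 2 * κ * r ^ 2) := by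
      apply mul_nonneg hp.le
      have : 0 ≤ dd - 1 := by linarith
      positivity
    nlinarith
  rcases le_total r (1 / (8 * K)) with h | h
  · have hrK : r * K ≤ 1 / 8 := by
      rw [le_div_iff₀ (by positivity)] at h; linarith
    have hr8 : r ≤ 1 / 8 := by nlinarith
    have hr2 : r ^ 2 ≤ 1 / 64 := by nlinarith
    have hPm : 0 ≤ (n * (1 + r ^ 2) ^ (κ - 1) * r) ^ m / m := by positivity
    have h2 : n * (1 + r ^ 2) ^ (κ - 1) * ib ≤ n * (1 + r ^ 2) ^ (κ - 2) * (1 / 4) := by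
      rw [e1]
      calc n * ((1 + r ^ 2) ^ (κ - 2) * (1 + r ^ 2)) * ib
          ≤ n * ((1 + r ^ 2) ^ (κ - 2) * (1 + r ^ 2)) * (K * r) := by gcongr
        _ = n * (1 + r ^ 2) ^ (κ - 2) * ((1 + r ^ 2) * (r * K)) := by ring
        _ ≤ n * (1 + r ^ 2) ^ (κ - 2) * (2 * (1 / 8)) := by gcongr; linarith
        _ = _ := by ring
    have h3 : n * (1 + r ^ 2) ^ (κ - 2) * (1 / 2) ≤ n * (1 + r ^ 2) ^ (κ - 2) * (1 - r ^ 2) := by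
      gcongr; linarith
    have h4 : (1 / 4 : ℝ) ≤ (1 + r ^ 2) ^ (κ - 2) := by
      calc (1 / 4 : ℝ) = 2 ^ (-2 : ℝ) := by
            rw [Real.rpow_neg (by norm_num)]; norm_num
        _ ≤ 2 ^ (κ - 2) := Real.rpow_le_rpow_of_exponent_le (by norm_num) (by linarith)
        _ ≤ _ := Real.rpow_le_rpow_of_nonpos hS (by linarith) (by linarith)
    have h5 : n * (1 / 4) ≤ n * (1 + r ^ 2) ^ (κ - 2) := by gcongr
    linarith
  · have hr : 0 < r := lt_of_lt_of_le (by positivity) h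
    set P := n * (1 + r ^ 2) ^ (κ - 1) * r with hP
    have hP0 : 0 < P := by positivity
    have hA : n * (1 + r ^ 2) ^ (κ - 1) ≤ 8 * K * P := by
      have : 1 ≤ 8 * K * r := by
        rw [div_le_iff₀ (by positivity)] at h; linarith
      have hA0 : 0 < n * (1 + r ^ 2) ^ (κ - 1) := by positivity
      rw [hP]; nlinarith
    have hPX : X' ≤ P := by
      rw [div_le_iff₀ hc20] at hnB
      refine hnB.trans ?_
      rw [hP, hc2, mul_assoc]
      gcongr
      rw [div_eq_mul_one_div]
      gcongr
      calc (1 + R ^ 2) ^ (-1 : ℝ) ≤ (1 + r ^ 2) ^ (-1 : ℝ) :=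
            Real.rpow_le_rpow_of_nonpos hS (by gcongr) (by norm_num)
        _ ≤ _ := Real.rpow_le_rpow_of_exponent_le (by nlinarith [sq_nonneg r]) (by linarith)
    have hPX1 : X ≤ P := le_trans (le_trans (le_max_left _ _) (le_max_left _ _)) hPX
    have hPX2 : β * W ≤ P := le_trans (le_trans (le_max_right _ _) (le_max_left _ _)) hPX
    have hPm : (9 * K + 1) * P ≤ P ^ m / m := by
      have h1 := hX P hPX1
      rw [le_div_iff₀ (by linarith)]
      have : P ^ m = P ^ (m - 1) * P := by
        rw [← Real.rpow_add_one hP0.ne']; congr 1; ring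
      rw [this]
      nlinarith
    have h2 : n * (1 + r ^ 2) ^ (κ - 1) * ib ≤ K * P := by
      calc n * (1 + r ^ 2) ^ (κ - 1) * ib ≤ n * (1 + r ^ 2) ^ (κ - 1) * (K * r) := by gcongr
        _ = _ := by rw [hP]; ring
    have h3 : -(n * (1 + r ^ 2) ^ (κ - 1)) ≤ n * (1 + r ^ 2) ^ (κ - 2) * (1 - r ^ 2) := by
      rw [e1]
      have hp : 0 < n * (1 + r ^ 2) ^ (κ - 2) := by positivity
      nlinarith
    linarith

/-- Elementary inequality: tangent line. -/
lemma tangent (m p s q : ℝ) (hm : 1 < m) (hp : 0 ≤ p) (hs : 0 ≤ s) (h : p - q ≤ s) :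
    p ^ m / m - p ^ (m - 1) * q ≤ s ^ m / m := by
  have hpm : 0 ≤ p ^ (m - 1) := by positivity
  have := Real.young_inequality_of_nonneg hs hpm (Real.HolderConjugate.conjExponent hm)
  simp only [Real.conjExponent] at this
  rw [← Real.rpow_mul hp] at this
  have e : (m - 1) * (m / (m - 1)) = m := by
    field_simp [show m - 1 ≠ 0 by linarith]
  rw [e] at this
  have e2 : p ^ m = p ^ (m - 1) * p := by
    rcases hp.eq_or_lt with h0 | h0
    · rw [← h0]; simp [Real.zero_rpow (show m ≠ 0 by linarith)]
    · rw [← Real.rpow_add_one h0.ne']; congr 1; ring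
  have e3 : p ^ m / (m / (m - 1)) = p ^ m - p ^ m / m := by
    field_simp [show m - 1 ≠ 0 by linarith]
  nlinarith

lemma pow_lower (m p s q : ℝ) (hm : 1 < m) (hp : 0 ≤ p) (hs : 0 ≤ s) (hq : 0 ≤ q)
    (h : q ≤ s + p) : 2 ^ (1 - m) * q ^ m - p ^ m ≤ s ^ m := by
  have h1 : q ^ m ≤ (s + p) ^ m := by gcongr
  have h3 : (s + p) ^ m ≤ 2 ^ (m - 1) * (s ^ m + p ^ m) := by
    have := NNReal.rpow_add_le_mul_rpow_add_rpow ⟨s, hs⟩ ⟨p, hp⟩ hm.le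
    exact_mod_cast this
  have e : (2:ℝ) ^ (1 - m) * 2 ^ (m - 1) = 1 := by
    rw [← Real.rpow_add (by norm_num)]; simp
  have : (2:ℝ) ^ (1 - m) * q ^ m ≤ 2 ^ (1 - m) * (2 ^ (m - 1) * (s ^ m + p ^ m)) := by
    gcongr; linarith
  rw [← mul_assoc, e] at this
  linarith

lemma F_deriv (n κ m L t : ℝ) (hκ : 0 < κ) (hm : 1 < m) (hL : 0 < L) (ht : -1 < t)
    (ht2 : t < L ^ 2) :
    HasDerivAt (fun t : ℝ => -(n / (2 * κ)) * (1 + t) ^ κ +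
        ((m - 1) * L / 2) * (1 - t / L ^ 2) ^ (-(1 / (m - 1))))
      (-(n / 2) * (1 + t) ^ (κ - 1) + (1 / (2 * L)) * (1 - t / L ^ 2) ^ (-(m / (m - 1)))) t := by
  have hm1 : m - 1 ≠ 0 := by linarith
  have h1 : HasDerivAt (fun t : ℝ => 1 + t) 1 t := (hasDerivAt_id t).const_add 1
  have h2 : HasDerivAt (fun t : ℝ => 1 - t / L ^ 2) (-(1 / L ^ 2)) t :=
    ((hasDerivAt_id t).div_const (L ^ 2)).const_sub 1
  have hpos : 0 < 1 - t / L ^ 2 := by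
    rw [sub_pos, div_lt_one (by positivity)]; exact ht2
  have h3 := (h1.rpow_const (p := κ) (Or.inl (by linarith))).const_mul (-(n / (2 * κ)))
  have h4 := (h2.rpow_const (p := -(1 / (m - 1))) (Or.inl hpos.ne')).const_mul ((m - 1) * L / 2)
  refine (h3.add h4).congr_deriv ?_
  have e : -(1 / (m - 1)) - 1 = -(m / (m - 1)) := by field_simp; ring
  rw [e]
  congr 1
  · field_simp
  · field_simp

lemma F1_deriv (n κ m L t : ℝ) (hL : 0 < L) (ht : -1 < t)
    (ht2 : t < L ^ 2) :
    HasDerivAt (fun t : ℝ => -(n / 2) * (1 + t) ^ (κ - 1) +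
        (1 / (2 * L)) * (1 - t / L ^ 2) ^ (-(m / (m - 1))))
      ((n / 2) * (1 - κ) * (1 + t) ^ (κ - 2) +
        ((m / (m - 1)) / (2 * L ^ 3)) * (1 - t / L ^ 2) ^ (-(m / (m - 1)) - 1)) t := by
  have h1 : HasDerivAt (fun t : ℝ => 1 + t) 1 t := (hasDerivAt_id t).const_add 1
  have h2 : HasDerivAt (fun t : ℝ => 1 - t / L ^ 2) (-(1 / L ^ 2)) t :=
    ((hasDerivAt_id t).div_const (L ^ 2)).const_sub 1
  have hpos : 0 < 1 - t / L ^ 2 := by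
    rw [sub_pos, div_lt_one (by positivity)]; exact ht2
  have h3 := (h1.rpow_const (p := κ - 1) (Or.inl (by linarith))).const_mul (-(n / 2))
  have h4 := (h2.rpow_const (p := -(m / (m - 1))) (Or.inl hpos.ne')).const_mul (1 / (2 * L))
  refine (h3.add h4).congr_deriv ?_
  have e : κ - 1 - 1 = κ - 2 := by ring
  rw [e]
  generalize m / (m - 1) = q
  congr 1
  · ring
  · field_simp

lemma F_blow (n κ m L : ℝ) (hm : 1 < m) (hL : 0 < L) :
    Tendsto (fun t : ℝ => -(n / (2 * κ)) * (1 + t) ^ κ +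
        ((m - 1) * L / 2) * (1 - t / L ^ 2) ^ (-(1 / (m - 1))))
      (nhdsWithin (L ^ 2) (Set.Iio (L ^ 2))) atTop := by
  have hq : 0 < 1 / (m - 1) := by
    have : 0 < m - 1 := by linarith
    positivity
  have hL2 : 0 < L ^ 2 := by positivity
  have h1 : Tendsto (fun t : ℝ => -(n / (2 * κ)) * (1 + t) ^ κ)
      (nhdsWithin (L ^ 2) (Set.Iio (L ^ 2))) (nhds (-(n / (2 * κ)) * (1 + L ^ 2) ^ κ)) := by
    have : ContinuousAt (fun t : ℝ => -(n / (2 * κ)) * (1 + t) ^ κ) (L ^ 2) := by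
      apply ContinuousAt.mul continuousAt_const
      exact ContinuousAt.rpow_const (by fun_prop) (Or.inl (by positivity))
    exact this.tendsto.mono_left nhdsWithin_le_nhds
  have h2 : Tendsto (fun t : ℝ => 1 - t / L ^ 2) (nhdsWithin (L ^ 2) (Set.Iio (L ^ 2)))
      (nhdsWithin 0 (Set.Ioi 0)) := by
    apply tendsto_nhdsWithin_of_tendsto_nhds_of_eventually_within
    · have : ContinuousAt (fun t : ℝ => 1 - t / L ^ 2) (L ^ 2) := by fun_prop
      have h := this.tendsto.mono_left (nhdsWithin_le_nhds (s := Set.Iio (L ^ 2)))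
      simpa [hL2.ne'] using h
    · filter_upwards [self_mem_nhdsWithin] with t ht
      have : t < L ^ 2 := ht
      simp only [Set.mem_Ioi, sub_pos]
      rw [div_lt_one hL2]; exact this
  have h3 := (tendsto_rpow_neg_nhdsGT_zero (y := -(1 / (m - 1))) (by linarith)).comp h2
  have h4 := h3.const_mul_atTop (show 0 < (m - 1) * L / 2 by
    have : 0 < m - 1 := by linarith
    positivity)
  exact h1.add_atTop h4

lemma B_common (q dd r L : ℝ) (hq : 1 < q) (hd : 0 ≤ dd) (hr : 0 ≤ r) (hL : 0 < L) (hrL : r < L) :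
    1 ≤ (1 - r ^ 2 / L ^ 2)⁻¹ ∧
    (1 / L) * (1 - r ^ 2 / L ^ 2) ^ (-q) = (1 / L) * (1 - r ^ 2 / L ^ 2)⁻¹ ^ q ∧
    dd * ((1 / L) * (1 - r ^ 2 / L ^ 2) ^ (-q)) +
      2 * r ^ 2 * (q / L ^ 3 * (1 - r ^ 2 / L ^ 2) ^ (-q - 1)) ≤
      (dd + 2 * q) / L * (1 - r ^ 2 / L ^ 2)⁻¹ ^ (q + 1) := by
  have hy : r ^ 2 / L ^ 2 < 1 := by
    rw [div_lt_one (by positivity)]; gcongr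
  have hy0 : 0 ≤ r ^ 2 / L ^ 2 := by positivity
  have hpos : 0 < 1 - r ^ 2 / L ^ 2 := by linarith
  have h1 : 1 ≤ (1 - r ^ 2 / L ^ 2)⁻¹ := (one_le_inv₀ hpos).2 (by linarith)
  have e1 : ∀ s : ℝ, (1 - r ^ 2 / L ^ 2) ^ (-s) = (1 - r ^ 2 / L ^ 2)⁻¹ ^ s := by
    intro s; rw [Real.rpow_neg hpos.le, Real.inv_rpow hpos.le]
  refine ⟨h1, by rw [e1], ?_⟩
  have e2 : -q - 1 = -(q + 1) := by ring
  rw [e2, e1, e1]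
  set u := (1 - r ^ 2 / L ^ 2)⁻¹
  have h2 : u ^ q ≤ u ^ (q + 1) := Real.rpow_le_rpow_of_exponent_le h1 (by linarith)
  have hu : 0 < u ^ (q + 1) := by positivity
  have a1 : dd * ((1 / L) * u ^ q) ≤ dd * ((1 / L) * u ^ (q + 1)) := by gcongr
  have a2 : 2 * r ^ 2 * (q / L ^ 3 * u ^ (q + 1)) = 2 * (r ^ 2 / L ^ 2) * (q / L * u ^ (q + 1)) := by
    field_simp
  have a3 : 2 * (r ^ 2 / L ^ 2) * (q / L * u ^ (q + 1)) ≤ 2 * 1 * (q / L * u ^ (q + 1)) := by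
    gcongr
  have a4 : (dd + 2 * q) / L * u ^ (q + 1) =
    dd * ((1 / L) * u ^ (q + 1)) + 2 * 1 * (q / L * u ^ (q + 1)) := by ring
  linarith

lemma u_le_two (r L : ℝ) (hr : 0 ≤ r) (hL : 0 < L) (hrL : 2 * r ≤ L) :
    (1 - r ^ 2 / L ^ 2)⁻¹ ≤ 2 := by
  have hy : r ^ 2 / L ^ 2 ≤ 1 / 4 := by
    rw [div_le_iff₀ (by positivity)]; nlinarith
  rw [inv_le_comm₀ (by linarith) (by norm_num)]
  linarith

lemma B_near (q dd C r0 ε : ℝ) (hq : 1 < q) (hd : 0 ≤ dd) (hC : 0 ≤ C) (hr0 : 0 < r0)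
    (hε : 0 < ε) :
    ∃ L1 : ℝ, ∀ L, L1 ≤ L → ∀ r, 0 ≤ r → r ≤ r0 →
      dd * ((1 / L) * (1 - r ^ 2 / L ^ 2) ^ (-q)) +
      2 * r ^ 2 * (q / L ^ 3 * (1 - r ^ 2 / L ^ 2) ^ (-q - 1)) +
      C * ((1 / L) * (1 - r ^ 2 / L ^ 2) ^ (-q) * r) ≤ ε := by
  refine ⟨max (2 * r0) ((dd + 2 * q + C * r0) * 2 ^ (q + 1) / ε), fun L hL r hr hrr => ?_⟩
  have hLa := le_trans (le_max_left _ _) hL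
  have hLb := le_trans (le_max_right _ _) hL
  have hL0 : 0 < L := by linarith
  obtain ⟨h1, h2, h3⟩ := B_common q dd r L hq hd hr hL0 (by linarith)
  have h4 := u_le_two r L hr hL0 (by linarith)
  rw [h2] at h3 ⊢
  set u := (1 - r ^ 2 / L ^ 2)⁻¹
  have h5 : u ^ q ≤ 2 ^ (q + 1) :=
    (Real.rpow_le_rpow_of_exponent_le h1 (by linarith)).trans
      (Real.rpow_le_rpow (by linarith) h4 (by linarith))
  have h6 : u ^ (q + 1) ≤ 2 ^ (q + 1) := Real.rpow_le_rpow (by linarith) h4 (by linarith)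
  have h7 : C * (1 / L * u ^ q * r) ≤ C * (1 / L * 2 ^ (q + 1) * r0) := by gcongr
  have h8 : (dd + 2 * q) / L * u ^ (q + 1) ≤ (dd + 2 * q) / L * 2 ^ (q + 1) := by gcongr
  have h9 : (dd + 2 * q) / L * 2 ^ (q + 1) + C * (1 / L * 2 ^ (q + 1) * r0) =
    (dd + 2 * q + C * r0) * 2 ^ (q + 1) / L := by ring
  have h10 : (dd + 2 * q + C * r0) * 2 ^ (q + 1) / L ≤ ε := by
    rw [div_le_iff₀ hε] at hLb
    rw [div_le_iff₀ hL0]; linarith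
  linarith

lemma B_far (m q dd c ε : ℝ) (hm : 1 < m) (hq : 1 < q) (hmq : q + 1 ≤ q * m) (hd : 0 ≤ dd)
    (hc : 0 < c) (hε : 0 < ε) :
    ∃ L2 : ℝ, ∀ L, L2 ≤ L → ∀ r, 0 ≤ r → r < L →
      dd * ((1 / L) * (1 - r ^ 2 / L ^ 2) ^ (-q)) +
      2 * r ^ 2 * (q / L ^ 3 * (1 - r ^ 2 / L ^ 2) ^ (-q - 1)) -
      c * ((1 / L) * (1 - r ^ 2 / L ^ 2) ^ (-q) * r) ^ m ≤ ε := by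
  refine ⟨max ((dd + 2 * q) * 2 ^ (q + 1) / ε) ((dd + 2 * q) * 2 ^ m / c), fun L hL r hr hrr => ?_⟩
  have hLa := le_trans (le_max_left _ _) hL
  have hLb := le_trans (le_max_right _ _) hL
  have hL0 : 0 < L := by linarith
  obtain ⟨h1, h2, h3⟩ := B_common q dd r L hq hd hr hL0 (by linarith)
  rw [h2] at h3 ⊢
  rcases le_total (2 * r) L with h | h
  · have h4 := u_le_two r L hr hL0 h
    set u := (1 - r ^ 2 / L ^ 2)⁻¹
    have h6 : u ^ (q + 1) ≤ 2 ^ (q + 1) := Real.rpow_le_rpow (by linarith) h4 (by linarith)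
    have h8 : (dd + 2 * q) / L * u ^ (q + 1) ≤ (dd + 2 * q) / L * 2 ^ (q + 1) := by gcongr
    have h10 : (dd + 2 * q) / L * 2 ^ (q + 1) ≤ ε := by
      rw [div_le_iff₀ hε] at hLa
      rw [div_mul_eq_mul_div, div_le_iff₀ hL0]; linarith
    have h11 : 0 ≤ c * (1 / L * u ^ q * r) ^ m := by positivity
    linarith
  · set u := (1 - r ^ 2 / L ^ 2)⁻¹
    have hu0 : 0 < u := by linarith
    have h4 : u ^ q / 2 ≤ 1 / L * u ^ q * r := by
      have : 1 / 2 ≤ r / L := by rw [le_div_iff₀ hL0]; linarith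
      calc u ^ q / 2 = u ^ q * (1 / 2) := by ring
        _ ≤ u ^ q * (r / L) := by gcongr
        _ = _ := by ring
    have h5 : (u ^ q / 2) ^ m ≤ (1 / L * u ^ q * r) ^ m := by gcongr
    have h6 : u ^ (q + 1) / 2 ^ m ≤ (u ^ q / 2) ^ m := by
      rw [Real.div_rpow (by positivity) (by norm_num), ← Real.rpow_mul hu0.le]
      gcongr
    have h7 : (dd + 2 * q) / L * u ^ (q + 1) ≤ c * (u ^ (q + 1) / 2 ^ m) := by
      have : (dd + 2 * q) / L ≤ c / 2 ^ m := by
        rw [div_le_iff₀ hc] at hLb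
        rw [div_le_div_iff₀ hL0 (by positivity)]; linarith
      calc _ ≤ c / 2 ^ m * u ^ (q + 1) := by gcongr
        _ = _ := by ring
    have h8 : c * (u ^ (q + 1) / 2 ^ m) ≤ c * (1 / L * u ^ q * r) ^ m := by
      gcongr; exact h6.trans h5
    linarith

lemma tail_bound (m ρ a η β n κ : ℝ) (hm : 1 < m) (hη : 0 < η) (hρ : 0 < ρ)
    (hκ1 : κ < 1 / 2) (hn : 0 < n) (δ : ℝ) (hδ : 0 < δ) :
    ∃ r0 : ℝ, ∀ r, r0 ≤ r → 0 ≤ ρ * r + a ∧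
      2 * (n * (1 + r ^ 2) ^ (κ - 1)) + (n * (1 + r ^ 2) ^ (κ - 1)) * (ρ * r + |a|)
      + (n * (1 + r ^ 2) ^ (κ - 1) * r) ^ m / m + β * r ^ (-η) ≤ δ := by
  have hS : Tendsto (fun r : ℝ => 1 + r ^ 2) atTop atTop :=
    tendsto_atTop_add_const_left _ _ (tendsto_pow_atTop (by norm_num))
  have hA : Tendsto (fun r : ℝ => n * (1 + r ^ 2) ^ (κ - 1)) atTop (nhds 0) := by
    have := ((tendsto_rpow_neg_atTop (show 0 < 1 - κ by linarith)).comp hS).const_mul n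
    simpa using this
  have hP : Tendsto (fun r : ℝ => n * (1 + r ^ 2) ^ (κ - 1) * r) atTop (nhds 0) := by
    have h1 := ((tendsto_rpow_neg_atTop (show 0 < 1 / 2 - κ by linarith)).comp hS).const_mul n
    rw [mul_zero] at h1
    refine tendsto_of_tendsto_of_tendsto_of_le_of_le' tendsto_const_nhds h1 ?_ ?_
    · filter_upwards [eventually_ge_atTop 0] with r hr
      positivity
    · filter_upwards [eventually_ge_atTop 0] with r hr
      simp only [Function.comp]
      have hS : 0 < 1 + r ^ 2 := by positivity
      have e : (1 + r ^ 2) ^ (-(1 / 2 - κ)) = (1 + r ^ 2) ^ (κ - 1) * (1 + r ^ 2) ^ (1 / 2 : ℝ) := by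
        rw [← Real.rpow_add hS]; congr 1; ring
      rw [e, mul_assoc]
      gcongr
      rw [← Real.sqrt_eq_rpow]
      exact Real.le_sqrt_of_sq_le (by linarith)
  have hJ : Tendsto (fun r : ℝ => 2 * (n * (1 + r ^ 2) ^ (κ - 1)) +
      (n * (1 + r ^ 2) ^ (κ - 1)) * (ρ * r + |a|)
      + (n * (1 + r ^ 2) ^ (κ - 1) * r) ^ m / m + β * r ^ (-η)) atTop (nhds 0) := by
    have h1 := hA.const_mul 2
    have h2 := (hP.const_mul ρ).add (hA.mul_const |a|)
    have h3 := (hP.rpow_const (p := m) (Or.inr (by linarith))).div_const m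
    have h4 := (tendsto_rpow_neg_atTop hη).const_mul β
    have h5 := ((h1.add h2).add h3).add h4
    rw [Real.zero_rpow (by linarith)] at h5
    simp only [mul_zero, zero_mul, zero_div, add_zero] at h5
    refine h5.congr fun r => ?_
    ring
  have hb : Tendsto (fun r : ℝ => ρ * r + a) atTop atTop :=
    tendsto_atTop_add_const_right _ _ (tendsto_id.const_mul_atTop hρ)
  obtain ⟨r0, h⟩ := eventually_atTop.1
    ((hb.eventually_ge_atTop 0).and (hJ.eventually_le_const hδ))
  exact ⟨r0, h⟩

lemma inner_ext {d : ℕ} {ρ R a η : ℝ} {b : Euc d → Euc d} {V : Euc d → ℝ} {α : Euc d → ℝ}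
    (hR : 0 < R) (hH1 : HypH1 0 ρ R a η b V α) (x : Euc d) (hx : R ≤ ‖x‖) :
    ⟪b x, x⟫ = ρ * ‖x‖ + a := by
  obtain ⟨⟨-, -, -, -, hb, -⟩, h1⟩ := hH1
  have hx0 : 0 < ‖x‖ := by linarith
  rw [hb x hx, (h1 x hx).1, inner_smul_left, real_inner_self_eq_norm_sq]
  simp only [conj_trivial, zero_sub, Real.rpow_neg_one]
  field_simp

lemma bdd_on_ball {d : ℕ} (f : Euc d → ℝ) (hf : Continuous f) (r : ℝ) :
    ∃ M, 1 ≤ M ∧ ∀ x : Euc d, ‖x‖ ≤ r → f x ≤ M := by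
  obtain ⟨M, hM⟩ := (isCompact_closedBall (0 : Euc d) r).bddAbove_image hf.continuousOn
  exact ⟨max 1 M, le_max_left _ _, fun x hx =>
    le_trans (hM ⟨x, by simpa using hx, rfl⟩) (le_max_right _ _)⟩

/-- The global strict supersolution. -/
lemma exists_super {d : ℕ} (hd : 1 ≤ d) (m ρ R a η : ℝ) (hm : 1 < m)
    (hρ : 0 < ρ) (hR : 0 < R)
    (b : Euc d → Euc d) (V : Euc d → ℝ) (α : Euc d → ℝ)
    (hH1 : HypH1 0 ρ R a η b V α)
    (hη1 : 1 < η) (ha : a < (d : ℝ) - 1) (β : ℝ) (hβ : 0 ≤ β) :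
    ∃ κ n : ℝ, 0 < κ ∧ κ < 1 / 2 ∧ 0 < n ∧ ∀ x : Euc d,
      -(d * (n * (1 + ‖x‖ ^ 2) ^ (κ - 1)) -
        2 * ‖x‖ ^ 2 * (n * (1 - κ) * (1 + ‖x‖ ^ 2) ^ (κ - 2)))
        + n * (1 + ‖x‖ ^ 2) ^ (κ - 1) * ⟪b x, x⟫
        - (n * (1 + ‖x‖ ^ 2) ^ (κ - 1) * ‖x‖) ^ m / m + β * V x
      < ρ ^ (m / (m - 1)) / (m / (m - 1)) := by
  have hm1 : 0 < m - 1 := by linarith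
  have hbc : Continuous b := hH1.1.1.continuous
  have hVc : Continuous V := hH1.1.2.1.continuous
  set γ := min (min ((d : ℝ) - 1 - a) (η - 1)) 1 / 2 with hγ
  have hγ0 : 0 < min (min ((d : ℝ) - 1 - a) (η - 1)) 1 := by
    refine lt_min (lt_min ?_ ?_) ?_ <;> linarith
  have hγ1 : min (min ((d : ℝ) - 1 - a) (η - 1)) 1 ≤ (d : ℝ) - 1 - a :=
    (min_le_left _ _).trans (min_le_left _ _)
  have hγ2 : min (min ((d : ℝ) - 1 - a) (η - 1)) 1 ≤ η - 1 :=
    (min_le_left _ _).trans (min_le_right _ _)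
  have hγ3 : min (min ((d : ℝ) - 1 - a) (η - 1)) 1 ≤ 1 := min_le_right _ _
  obtain ⟨K, hK1, hK⟩ := bdd_on_ball (fun x => ‖b x‖) hbc.norm R
  obtain ⟨W, hW1, hW⟩ := bdd_on_ball V hVc R
  have hd' : (1 : ℝ) ≤ d := by exact_mod_cast hd
  obtain ⟨n1, h1⟩ := ext_bound m ρ a η β R ((1 - γ) / 2) d hm hρ hβ hR (by linarith)
    (by linarith) (by linarith)
  obtain ⟨n2, h2⟩ := int_bound m β R ((1 - γ) / 2) d K W hm hβ (by linarith) (by linarith)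
    hd' hK1 (by linarith)
  refine ⟨(1 - γ) / 2, max (max n1 n2) 1, by linarith, by linarith,
    lt_of_lt_of_le one_pos (le_max_right _ _), fun x => ?_⟩
  have hn0 : 0 < max (max n1 n2) 1 := lt_of_lt_of_le one_pos (le_max_right _ _)
  rcases le_total R ‖x‖ with hx | hx
  · have := h1 _ ((le_max_left _ _).trans (le_max_left _ _)) hn0 ‖x‖ hx
    rw [inner_ext hR hH1 x hx, (hH1.2 x hx).2]
    exact this
  · have := h2 _ ((le_max_right _ _).trans (le_max_left _ _)) hn0 ‖x‖ (norm_nonneg x) hx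
      ⟪b x, x⟫ (V x) ((real_inner_le_norm _ _).trans (by gcongr; exact hK x hx)) (hW x hx)
    refine lt_of_le_of_lt this ?_
    positivity

lemma A2_le (n κ r : ℝ) (hn : 0 < n) (hκ0 : 0 < κ) :
    r ^ 2 * (n * (1 - κ) * (1 + r ^ 2) ^ (κ - 2)) ≤ n * (1 + r ^ 2) ^ (κ - 1) := by
  have hS0 : 0 < 1 + r ^ 2 := by positivity
  have e1 : (1 + r ^ 2) ^ (κ - 1) = (1 + r ^ 2) ^ (κ - 2) * (1 + r ^ 2) := by
    rw [← Real.rpow_add_one hS0.ne']; congr 1; ring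
  rw [e1]
  have : 0 ≤ n * (1 + r ^ 2) ^ (κ - 2) * (1 + κ * r ^ 2) := by positivity
  linarith

lemma A_le (n κ r : ℝ) (hn : 0 < n) (hκ1 : κ < 1 / 2) :
    n * (1 + r ^ 2) ^ (κ - 1) ≤ n := by
  have hS : 1 ≤ 1 + r ^ 2 := by linarith [sq_nonneg r]
  have := Real.rpow_le_one_of_one_le_of_nonpos hS (show κ - 1 ≤ 0 by linarith)
  exact mul_le_of_le_one_right hn.le this

set_option maxHeartbeats 1000000 in
lemma upper {d : ℕ} (hd : 1 ≤ d) (m ρ R a η : ℝ) (hm : 1 < m)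
    (hρ : 0 < ρ) (hR : 0 < R)
    (b : Euc d → Euc d) (V : Euc d → ℝ) (α : Euc d → ℝ)
    (hH1 : HypH1 0 ρ R a η b V α)
    (hη1 : 1 < η) (ha : a < (d : ℝ) - 1) (β : ℝ) (hβ : 0 ≤ β) :
    ∃ ε : ℝ, 0 < ε ∧ ∀ lam φ, IsSubsol m b V β lam φ →
      lam ≤ ρ ^ (m / (m - 1)) / (m / (m - 1)) - ε := by
  have hm1 : 0 < m - 1 := by linarith
  obtain ⟨κ, n, hκ0, hκ1, hn, hE⟩ := exists_super hd m ρ R a η hm hρ hR b V α hH1 hη1 ha β hβ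
  have hbc : Continuous b := hH1.1.1.continuous
  have hVc : Continuous V := hH1.1.2.1.continuous
  have hΛ : 0 < ρ ^ (m / (m - 1)) / (m / (m - 1)) := by positivity
  set Λ := ρ ^ (m / (m - 1)) / (m / (m - 1)) with hΛdef
  have hq : 1 < m / (m - 1) := by rw [lt_div_iff₀ hm1]; linarith
  have hqm : m / (m - 1) + 1 ≤ m / (m - 1) * m := by
    have : m / (m - 1) * m = m / (m - 1) + m := by field_simp; ring
    linarith
  set q := m / (m - 1) with hqdef
  obtain ⟨r0', hr0'⟩ := tail_bound m ρ a η β n κ hm (by linarith) hρ hκ1 hn (Λ / 2) (by linarith)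
  set r0 := max r0' R with hr0def
  have hr0R : R ≤ r0 := le_max_right _ _
  have hr0pos : 0 < r0 := by linarith
  -- the maximum of the strict supersolution on a ball
  have hcont : Continuous (fun x : Euc d => -(d * (n * (1 + ‖x‖ ^ 2) ^ (κ - 1)) -
        2 * ‖x‖ ^ 2 * (n * (1 - κ) * (1 + ‖x‖ ^ 2) ^ (κ - 2)))
        + n * (1 + ‖x‖ ^ 2) ^ (κ - 1) * ⟪b x, x⟫
        - (n * (1 + ‖x‖ ^ 2) ^ (κ - 1) * ‖x‖) ^ m / m + β * V x) := by
    have hpow : ∀ s : ℝ, Continuous (fun x : Euc d => (1 + ‖x‖ ^ 2) ^ s) := fun s =>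
      Continuous.rpow_const (by fun_prop) (fun x => Or.inl (by positivity))
    have h1 := hpow (κ - 1)
    have h2 := hpow (κ - 2)
    have h3 : Continuous (fun x : Euc d => (n * (1 + ‖x‖ ^ 2) ^ (κ - 1) * ‖x‖) ^ m) :=
      Continuous.rpow_const (by fun_prop) (fun x => Or.inr (by linarith))
    have h4 : Continuous (fun x : Euc d => ⟪b x, x⟫) := hbc.inner continuous_id
    fun_prop
  obtain ⟨xm, hxm, hmax⟩ := (isCompact_closedBall (0 : Euc d) r0).exists_isMaxOn
    ⟨0, by simp [hr0pos.le]⟩ hcont.continuousOn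
  have hgap := hE xm
  set E0 := -(d * (n * (1 + ‖xm‖ ^ 2) ^ (κ - 1)) -
        2 * ‖xm‖ ^ 2 * (n * (1 - κ) * (1 + ‖xm‖ ^ 2) ^ (κ - 2)))
        + n * (1 + ‖xm‖ ^ 2) ^ (κ - 1) * ⟪b xm, xm⟫
        - (n * (1 + ‖xm‖ ^ 2) ^ (κ - 1) * ‖xm‖) ^ m / m + β * V xm with hE0
  set ε := min ((Λ - E0) / 2) (Λ / 4) with hε
  have hε0 : 0 < ε := lt_min (by linarith) (by linarith)
  have hε1 : ε ≤ (Λ - E0) / 2 := min_le_left _ _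
  have hε2 : ε ≤ Λ / 4 := min_le_right _ _
  obtain ⟨K, hK1, hK⟩ := bdd_on_ball (fun x => ‖b x‖) hbc.norm r0
  obtain ⟨L1, hL1⟩ := B_near q d (K + (n * r0) ^ (m - 1)) r0 ε hq (by positivity)
    (by positivity) hr0pos hε0
  obtain ⟨L2, hL2⟩ := B_far m q d (2 ^ (1 - m) / m) (Λ / 4) hm hq hqm (by positivity)
    (by positivity) (by linarith)
  refine ⟨ε, hε0, fun lam φ hφ => ?_⟩
  set L := max (max L1 L2) 1 with hLdef
  have hLa : L1 ≤ L := (le_max_left _ _).trans (le_max_left _ _)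
  have hLb : L2 ≤ L := (le_max_right _ _).trans (le_max_left _ _)
  have hL0 : 0 < L := lt_of_lt_of_le one_pos (le_max_right _ _)
  obtain ⟨x, hxL, hgrad, hlap⟩ := exists_touch φ hφ.1 _ _ _ L hL0
    (fun t h1 h2 => F_deriv n κ m L t hκ0 hm hL0 h1 h2)
    (fun t h1 h2 => F1_deriv n κ m L t hL0 h1 h2) (F_blow n κ m L hm hL0)
  have hsub := hφ.2 x
  rw [← hqdef] at hgrad hlap
  clear_value L ε E0 q r0
  have hr : 0 ≤ ‖x‖ := norm_nonneg x
  have hS : 1 ≤ 1 + ‖x‖ ^ 2 := by nlinarith [sq_nonneg ‖x‖]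
  have hS0 : 0 < 1 + ‖x‖ ^ 2 := by linarith
  have hy : 0 < 1 - ‖x‖ ^ 2 / L ^ 2 := by
    rw [sub_pos, div_lt_one (by positivity)]; gcongr
  have nearE : ‖x‖ ≤ r0 → _ := fun h =>
    hmax (show x ∈ Metric.closedBall 0 r0 by simpa using h)
  simp only [Set.mem_ofPred_eq] at nearE
  rw [← hE0] at nearE
  have nearB := hL1 L hLa ‖x‖ hr
  have farB := hL2 L hLb ‖x‖ hr hxL
  have farA := fun h : r0 ≤ ‖x‖ => hr0' ‖x‖ ((le_max_left r0' R).trans (hr0def ▸ h))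
  have hA2 := A2_le n κ ‖x‖ hn hκ0
  have hAn := A_le n κ ‖x‖ hn hκ1
  have hgrad' : gradient φ x = ((1 / L) * (1 - ‖x‖ ^ 2 / L ^ 2) ^ (-q)
      - n * (1 + ‖x‖ ^ 2) ^ (κ - 1)) • x := by
    rw [hgrad]; congr 1; field_simp; ring
  have hlap' : lap φ x ≤ d * ((1 / L) * (1 - ‖x‖ ^ 2 / L ^ 2) ^ (-q)
      - n * (1 + ‖x‖ ^ 2) ^ (κ - 1)) + 2 * ‖x‖ ^ 2 * (q / L ^ 3 *
        (1 - ‖x‖ ^ 2 / L ^ 2) ^ (-q - 1) + n * (1 - κ) * (1 + ‖x‖ ^ 2) ^ (κ - 2)) := by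
    refine hlap.trans (le_of_eq ?_)
    field_simp
    ring
  have hA0 : 0 < n * (1 + ‖x‖ ^ 2) ^ (κ - 1) := by positivity
  have hB0 : 0 < (1 / L) * (1 - ‖x‖ ^ 2 / L ^ 2) ^ (-q) := by positivity
  have hB20 : 0 < q / L ^ 3 * (1 - ‖x‖ ^ 2 / L ^ 2) ^ (-q - 1) := by positivity
  rw [hgrad', inner_smul_right, norm_smul, Real.norm_eq_abs] at hsub
  generalize n * (1 + ‖x‖ ^ 2) ^ (κ - 1) = A at *
  generalize (1 / L) * (1 - ‖x‖ ^ 2 / L ^ 2) ^ (-q) = B at *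
  generalize q / L ^ 3 * (1 - ‖x‖ ^ 2 / L ^ 2) ^ (-q - 1) = B2 at *
  generalize n * (1 - κ) * (1 + ‖x‖ ^ 2) ^ (κ - 2) = A2 at *
  have hs : (0 : ℝ) ≤ |B - A| * ‖x‖ := by positivity
  have e1m : 1 / m * (|B - A| * ‖x‖) ^ m = (|B - A| * ‖x‖) ^ m / m := by ring
  rw [e1m] at hsub
  rcases le_total ‖x‖ r0 with hx | hx
  · have hT := tangent m (A * ‖x‖) (|B - A| * ‖x‖) (B * ‖x‖) hm (by positivity) hs
      (by
        have := neg_abs_le (B - A)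
        nlinarith)
    have h1 := nearE hx
    have h2 := nearB hx
    have h3 : -(B * ⟪b x, x⟫) ≤ B * (K * ‖x‖) := by
      have := (abs_le.1 (abs_real_inner_le_norm (b x) x)).1
      have h4 : ‖b x‖ * ‖x‖ ≤ K * ‖x‖ := by gcongr; exact hK x hx
      nlinarith
    have h4 : (A * ‖x‖) ^ (m - 1) * (B * ‖x‖) ≤ (n * r0) ^ (m - 1) * (B * ‖x‖) := by
      gcongr
    linarith
  · obtain ⟨h1, h2⟩ := farA hx
    have hT := pow_lower m (A * ‖x‖) (|B - A| * ‖x‖) (B * ‖x‖) hm (by positivity) hs (by positivity)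
      (by
        have := le_abs_self (B - A)
        nlinarith)
    have hT' : 2 ^ (1 - m) / m * (B * ‖x‖) ^ m - (A * ‖x‖) ^ m / m ≤ (|B - A| * ‖x‖) ^ m / m := by
      have := div_le_div_of_nonneg_right hT (show 0 ≤ m by linarith)
      refine le_trans (le_of_eq ?_) this
      ring
    rw [inner_ext hR hH1 x (by linarith), (hH1.2 x (by linarith)).2] at hsub
    have h3 : 0 ≤ B * (ρ * ‖x‖ + a) := by positivity
    have h4 : A * (ρ * ‖x‖ + a) ≤ A * (ρ * ‖x‖ + |a|) := by
      gcongr; exact le_abs_self a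
    have h5 : 0 ≤ d * A := by positivity
    linarith

lemma c_identity (m ρ : ℝ) (hm : 1 < m) (hρ : 0 < ρ) :
    -(ρ * ρ ^ (1 / (m - 1))) + (ρ ^ (1 / (m - 1))) ^ m / m =
      -(ρ ^ (m / (m - 1)) / (m / (m - 1))) := by
  have hm1 : m - 1 ≠ 0 := by linarith
  have e1 : ρ * ρ ^ (1 / (m - 1)) = ρ ^ (m / (m - 1)) := by
    rw [mul_comm, ← Real.rpow_add_one hρ.ne']; congr 1; field_simp; ring
  have e2 : (ρ ^ (1 / (m - 1))) ^ m = ρ ^ (m / (m - 1)) := by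
    rw [← Real.rpow_mul hρ.le]; congr 1; field_simp
  rw [e1, e2]
  field_simp
  ring

lemma low_tail (m ρ a dd c : ℝ) (hm : 1 < m) :
    Tendsto (fun r : ℝ => dd * (c * (1 + r ^ 2) ^ (-(1 / 2) : ℝ)) -
      c * (1 + r ^ 2) ^ (-(1 / 2) : ℝ) * (ρ * r + a) +
      (c * (1 + r ^ 2) ^ (-(1 / 2) : ℝ) * r) ^ m / m) atTop
      (nhds (-(ρ * c) + c ^ m / m)) := by
  have hS : Tendsto (fun r : ℝ => 1 + r ^ 2) atTop atTop :=
    tendsto_atTop_add_const_left _ _ (tendsto_pow_atTop (by norm_num))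
  have hA : Tendsto (fun r : ℝ => c * (1 + r ^ 2) ^ (-(1 / 2) : ℝ)) atTop (nhds 0) := by
    have := ((tendsto_rpow_neg_atTop (show (0 : ℝ) < 1 / 2 by norm_num)).comp hS).const_mul c
    simpa using this
  have hP0 : Tendsto (fun r : ℝ => (1 + r ^ 2) ^ (-(1 / 2) : ℝ) * r) atTop (nhds 1) := by
    have h1 : Tendsto (fun r : ℝ => √(1 - (1 + r ^ 2)⁻¹)) atTop (nhds 1) := by
      have := ((tendsto_inv_atTop_zero.comp hS).const_sub 1).sqrt
      simpa using this
    refine h1.congr' ?_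
    filter_upwards [eventually_ge_atTop 0] with r hr
    have hS0 : 0 < 1 + r ^ 2 := by positivity
    rw [Real.rpow_neg hS0.le, ← Real.sqrt_eq_rpow]
    have : 1 - (1 + r ^ 2)⁻¹ = r ^ 2 / (1 + r ^ 2) := by field_simp; ring
    rw [this, Real.sqrt_div (by positivity), Real.sqrt_sq hr]
    ring
  have hP : Tendsto (fun r : ℝ => c * (1 + r ^ 2) ^ (-(1 / 2) : ℝ) * r) atTop (nhds c) := by
    have := hP0.const_mul c
    rw [mul_one] at this
    exact this.congr fun r => by ring
  have h1 := hA.const_mul dd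
  have h2 := (hP.const_mul ρ).add (hA.mul_const a)
  have h3 := (hP.rpow_const (p := m) (Or.inr (by linarith))).div_const m
  have h5 := (h1.sub h2).add h3
  simp only [mul_zero, zero_mul, add_zero, zero_sub] at h5
  refine h5.congr fun r => ?_
  ring

lemma lower {d : ℕ} (m ρ R a η : ℝ) (hm : 1 < m)
    (hρ : 0 < ρ) (hR : 0 < R)
    (b : Euc d → Euc d) (V : Euc d → ℝ) (α : Euc d → ℝ)
    (hH1 : HypH1 0 ρ R a η b V α) (ε : ℝ) (hε : 0 < ε) :
    ∃ β0 : ℝ, 0 ≤ β0 ∧ ∀ β, β0 ≤ β → ∃ φ,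
      IsSubsol m b V β (ρ ^ (m / (m - 1)) / (m / (m - 1)) - ε) φ := by
  have hbc : Continuous b := hH1.1.1.continuous
  have hVc : Continuous V := hH1.1.2.1.continuous
  obtain ⟨⟨-, -, -, -, -, -, hV0, hsupp, -⟩, hext⟩ := id hH1
  set c := ρ ^ (1 / (m - 1)) with hc
  have hc0 : 0 < c := by positivity
  have htail := low_tail m ρ a d c hm
  rw [hc, c_identity m ρ hm hρ, ← hc] at htail
  set Λ := ρ ^ (m / (m - 1)) / (m / (m - 1)) with hΛ
  obtain ⟨r0', hr0'⟩ := eventually_atTop.1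
    (htail.eventually_le_const (show -Λ < -Λ + ε by linarith))
  set r0 := max r0' R with hr0
  have hVpos : ∀ x : Euc d, 0 < V x := by
    intro x
    rcases le_total ‖x‖ R with hx | hx
    · have : x ∈ Function.support V := interior_subset (hsupp (by simpa using hx))
      exact lt_of_le_of_ne (hV0 x) (Ne.symm this)
    · rw [(hext x hx).2]
      have : 0 < ‖x‖ := by linarith
      positivity
  have hr0R : R ≤ r0 := le_max_right _ _
  obtain ⟨xm, hxm, hmin⟩ := (isCompact_closedBall (0 : Euc d) r0).exists_isMinOn
    ⟨0, by simp; linarith⟩ hVc.continuousOn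
  have hv0 := hVpos xm
  have hpow : Continuous (fun x : Euc d => (1 + ‖x‖ ^ 2) ^ (-(1 / 2) : ℝ)) :=
    Continuous.rpow_const (by fun_prop) (fun x => Or.inl (by positivity))
  obtain ⟨M, hM1, hM⟩ := bdd_on_ball (fun x : Euc d => Λ +
      (d * (c * (1 + ‖x‖ ^ 2) ^ (-(1 / 2) : ℝ)) -
      c * (1 + ‖x‖ ^ 2) ^ (-(1 / 2) : ℝ) * ⟪b x, x⟫ +
      (c * (1 + ‖x‖ ^ 2) ^ (-(1 / 2) : ℝ) * ‖x‖) ^ m / m)) (by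
    have h3 : Continuous (fun x : Euc d => (c * (1 + ‖x‖ ^ 2) ^ (-(1 / 2) : ℝ) * ‖x‖) ^ m) :=
      Continuous.rpow_const (by fun_prop) (fun x => Or.inr (by linarith))
    have h4 : Continuous (fun x : Euc d => ⟪b x, x⟫) := hbc.inner continuous_id
    fun_prop) r0
  refine ⟨M / V xm, by positivity, fun β hβ => ?_⟩
  have hβ0 : 0 ≤ β := le_trans (by positivity) hβ
  have hd1 : ∀ t : ℝ, -1 < t → HasDerivAt (fun t : ℝ => -c * (1 + t) ^ (1 / 2 : ℝ))
      (-(c / 2) * (1 + t) ^ (-(1 / 2) : ℝ)) t := by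
    intro t ht
    have h1 : HasDerivAt (fun t : ℝ => 1 + t) 1 t := (hasDerivAt_id t).const_add 1
    refine ((h1.rpow_const (p := 1 / 2) (Or.inl (by linarith))).const_mul (-c)).congr_deriv ?_
    norm_num
    ring
  have hd2 : ∀ t : ℝ, -1 < t → HasDerivAt (fun t : ℝ => -(c / 2) * (1 + t) ^ (-(1 / 2) : ℝ))
      ((c / 4) * (1 + t) ^ (-(3 / 2) : ℝ)) t := by
    intro t ht
    have h1 : HasDerivAt (fun t : ℝ => 1 + t) 1 t := (hasDerivAt_id t).const_add 1
    refine ((h1.rpow_const (p := -(1 / 2)) (Or.inl (by linarith))).const_mul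
      (-(c / 2))).congr_deriv ?_
    norm_num
    ring
  refine ⟨fun x => -c * (1 + ‖x‖ ^ 2) ^ (1 / 2 : ℝ), ?_, fun x => ?_⟩
  · apply ContDiff.mul contDiff_const
    apply ContDiff.rpow_const_of_ne
    · exact contDiff_const.add (contDiff_norm_sq ℝ)
    · intro x; positivity
  have ht : -1 < ‖x‖ ^ 2 := by nlinarith [sq_nonneg ‖x‖]
  have hg := rad_grad _ _ x (hd1 _ ht)
  have hl := rad_lap _ _ _ x (Filter.mem_of_superset (Ioi_mem_nhds ht) (fun t h => hd1 t h))
    (hd2 _ ht)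
  rw [hg, hl, inner_smul_right, norm_smul, Real.norm_eq_abs]
  have hA0 : 0 < (1 + ‖x‖ ^ 2) ^ (-(1 / 2) : ℝ) := by positivity
  have e1 : 2 * (-(c / 2) * (1 + ‖x‖ ^ 2) ^ (-(1 / 2) : ℝ)) =
    -(c * (1 + ‖x‖ ^ 2) ^ (-(1 / 2) : ℝ)) := by ring
  have hA3 : 0 ≤ 4 * ‖x‖ ^ 2 * (c / 4 * (1 + ‖x‖ ^ 2) ^ (-(3 / 2) : ℝ)) := by positivity
  have e2 : |-(c * (1 + ‖x‖ ^ 2) ^ (-(1 / 2) : ℝ))| = c * (1 + ‖x‖ ^ 2) ^ (-(1 / 2) : ℝ) := by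
    rw [abs_neg, abs_of_pos (by positivity)]
  have e3 : ∀ X : ℝ, 1 / m * X ^ m = X ^ m / m := fun X => by ring
  rw [e1, e2, e3]
  rcases le_total ‖x‖ r0 with hx | hx
  · have h1 := hM x hx
    have h2 : V xm ≤ V x := hmin (show x ∈ Metric.closedBall 0 r0 by simpa using hx)
    have h3 : M ≤ β * V x := by
      rw [div_le_iff₀ hv0] at hβ
      exact hβ.trans (by gcongr)
    generalize (c * (1 + ‖x‖ ^ 2) ^ (-(1 / 2) : ℝ) * ‖x‖) ^ m / m = Q at *
    generalize 4 * ‖x‖ ^ 2 * (c / 4 * (1 + ‖x‖ ^ 2) ^ (-(3 / 2) : ℝ)) = T at *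
    generalize (1 + ‖x‖ ^ 2) ^ (-(1 / 2) : ℝ) = A at *
    linarith
  · have h1 := hr0' ‖x‖ ((le_max_left _ _).trans hx)
    rw [inner_ext hR hH1 x (by linarith)]
    have h2 : 0 ≤ β * V x := mul_nonneg hβ0 (hV0 x)
    generalize (c * (1 + ‖x‖ ^ 2) ^ (-(1 / 2) : ℝ) * ‖x‖) ^ m / m = Q at *
    generalize 4 * ‖x‖ ^ 2 * (c / 4 * (1 + ‖x‖ ^ 2) ^ (-(3 / 2) : ℝ)) = T at *
    generalize (1 + ‖x‖ ^ 2) ^ (-(1 / 2) : ℝ) = A at *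
    linarith

/-- if `η > 1` and `a < d - 1`, there is no plateau, although
`λ_max(β) → ρ^{m*}/m*` as `β → ∞`. -/
theorem stmt13 (d : ℕ) (hd : 1 ≤ d) (m ρ R a η : ℝ) (hm : 1 < m)
    (hρ : 0 < ρ) (hη : 0 < η) (hR : 0 < R)
    (mst : ℝ) (hmst : mst = m / (m - 1))
    (b : Euc d → Euc d) (V : Euc d → ℝ) (α : Euc d → ℝ)
    (hH1 : HypH1 0 ρ R a η b V α)
    (hη1 : 1 < η) (ha : a < (d : ℝ) - 1) :
    (∀ β : ℝ, 0 ≤ β → lamMax m b V β < ρ ^ mst / mst) ∧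
      Tendsto (fun β : ℝ => lamMax m b V β) atTop (nhds (ρ ^ mst / mst)) := by
  subst hmst
  have hne : ∀ β : ℝ, 0 ≤ β → {lam : ℝ | ∃ φ : Euc d → ℝ, IsSubsol m b V β lam φ}.Nonempty := by
    intro β hβ
    refine ⟨0, fun _ => 0, contDiff_const, fun x => ?_⟩
    have h0 : gradient (fun _ : Euc d => (0 : ℝ)) x = 0 := by simp [gradient]
    have h1 : lap (fun _ : Euc d => (0 : ℝ)) x = 0 := by simp [lap]
    have h2 : 0 ≤ β * V x := mul_nonneg hβ (hH1.1.2.2.2.2.2.2.1 x)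
    rw [h0, h1, inner_zero_right, norm_zero, Real.zero_rpow (by linarith)]
    linarith
  have hlt : ∀ β : ℝ, 0 ≤ β → lamMax m b V β < ρ ^ (m / (m - 1)) / (m / (m - 1)) := by
    intro β hβ
    obtain ⟨ε, hε, h⟩ := upper hd m ρ R a η hm hρ hR b V α hH1 hη1 ha β hβ
    have : lamMax m b V β ≤ ρ ^ (m / (m - 1)) / (m / (m - 1)) - ε :=
      csSup_le (hne β hβ) (fun lam ⟨φ, hφ⟩ => h lam φ hφ)
    linarith
  refine ⟨hlt, ?_⟩
  rw [tendsto_order]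
  constructor
  · intro l hl
    set Λ := ρ ^ (m / (m - 1)) / (m / (m - 1)) with hΛ
    obtain ⟨β0, hβ0, h⟩ := lower m ρ R a η hm hρ hR b V α hH1 ((Λ - l) / 2) (by linarith)
    filter_upwards [eventually_ge_atTop β0] with β hβ
    obtain ⟨ε, hε, hu⟩ := upper hd m ρ R a η hm hρ hR b V α hH1 hη1 ha β (hβ0.trans hβ)
    have : Λ - (Λ - l) / 2 ≤ lamMax m b V β :=
      le_csSup ⟨_, fun lam ⟨φ, hφ⟩ => hu lam φ hφ⟩ (h β hβ)
    linarith
  · intro u hu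
    filter_upwards [eventually_ge_atTop 0] with β hβ
    exact (hlt β hβ).trans hu

end
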